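/- Let n ≥ 1 be a natural number and α, β₁,…,βₙ be external numbers with R(α) ≤ R(βᵢ) for all i = 1,…,n (i.e. R(α) ≤ min_{1≤i≤n} R(βᵢ)). Then α(β₁ + ⋯ + βₙ) = αβ₁ + ⋯ + αβₙ. -/

import Mathlib

open scoped Pointwise Classical

noncomputable section

-- Note: `ℝ*` is Mathlib's notation for the hyperreals `Hyperreal`.

/-- A neutrix: an order-convex additive subgroup of the hyperreals. -/
def IsNeutrix (A : Set ℝ*) : Prop :=
  (0 : ℝ*) ∈ A ∧ (∀ x ∈ A, ∀ y ∈ A, x + y ∈ A) ∧ (∀ x ∈ A, -x ∈ A) ∧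
    ∀ x ∈ A, ∀ y ∈ A, ∀ z : ℝ*, x ≤ z → z ≤ y → z ∈ A

/-- The coset `a + A`. -/
def coset (a : ℝ*) (A : Set ℝ*) : Set ℝ* := {x | ∃ u ∈ A, x = a + u}

/-- `α` is an external number: a coset of a neutrix. -/
def IsExt (α : Set ℝ*) : Prop := ∃ a A, IsNeutrix A ∧ α = coset a A

/-- The neutrix part `N(α)` of an external number, as the set of differences. -/
def Nx (α : Set ℝ*) : Set ℝ* := {d | ∃ x ∈ α, ∃ y ∈ α, d = x - y}

/-- An external number is zeroless if it does not contain `0`. -/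
def Zeroless (α : Set ℝ*) : Prop := (0 : ℝ*) ∉ α

/-- Multiplication of external numbers: `αβ = ab + aB + bA + AB`
(independent of the chosen representatives). -/
def emul (α β : Set ℝ*) : Set ℝ* :=
  {z | ∃ a A b B, IsNeutrix A ∧ IsNeutrix B ∧ α = coset a A ∧ β = coset b B ∧
      ∃ u ∈ A, ∃ v ∈ B, ∃ u' ∈ A, ∃ v' ∈ B, z = a * b + a * v + b * u + u' * v'}

/-- Multiplication of an external number by a hyperreal scalar: `t·α = ta + tA`. -/
def esmul (t : ℝ*) (α : Set ℝ*) : Set ℝ* := (fun x => t * x) '' α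

/-- Inverse of a (zeroless) external number: `1/α = 1/a + A/a²`. -/
def einv (α : Set ℝ*) : Set ℝ* :=
  {z | ∃ a A, IsNeutrix A ∧ α = coset a A ∧ ∃ u ∈ A, z = a⁻¹ + u / a ^ 2}

/-- Division of external numbers: `α/β = α · (1/β)`. -/
def ediv (α β : Set ℝ*) : Set ℝ* := emul α (einv β)

/-- The neutrix `⊘` of infinitesimal hyperreals. -/
def oslash : Set ℝ* := {x | Hyperreal.Infinitesimal x}

/-- Relative uncertainty `R(α)`: `A/a` if `α = a + A` is zeroless,
and all of `ℝ*` if `α` is a neutrix. -/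
def RU (α : Set ℝ*) : Set ℝ* :=
  if (0 : ℝ*) ∈ α then Set.univ
  else {z | ∃ a A, IsNeutrix A ∧ α = coset a A ∧ ∃ u ∈ A, z = u / a}

/-- `α` and `β` are nearly opposite: both zeroless and `α/β ⊆ -1 + ⊘`. -/
def NearlyOpposite (α β : Set ℝ*) : Prop :=
  Zeroless α ∧ Zeroless β ∧ ediv α β ⊆ coset (-1) oslash

/-- Order on external numbers: `α ≤ β` iff `∀ x ∈ α, ∃ y ∈ β, x ≤ y`. -/
def ele (α β : Set ℝ*) : Prop := ∀ x ∈ α, ∃ y ∈ β, x ≤ y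

/-- `α` is non-negative: some element of `α` is `≥ 0`. -/
def eNonneg (α : Set ℝ*) : Prop := ∃ x ∈ α, (0 : ℝ*) ≤ x

/-- Absolute value of an external number: `|α| = |a| + A`. -/
def eabs (α : Set ℝ*) : Set ℝ* :=
  {z | ∃ a A, IsNeutrix A ∧ α = coset a A ∧ ∃ u ∈ A, z = |a| + u}

/-- Product of a finite family of external numbers. -/
def eprod : ∀ {n : ℕ}, (Fin n → Set ℝ*) → Set ℝ*
  | 0, _ => {1}
  | _ + 1, f => emul (f 0) (eprod fun i => f i.succ)

/-- Power of an external number. -/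
def epow (α : Set ℝ*) : ℕ → Set ℝ*
  | 0 => {1}
  | k + 1 => emul α (epow α k)

/-- Matrix product over external numbers: `(AB)_{ij} = Σ_k α_{ik}β_{kj}`. -/
def matMul {m n p : ℕ} (M : Matrix (Fin m) (Fin n) (Set ℝ*))
    (N : Matrix (Fin n) (Fin p) (Set ℝ*)) : Matrix (Fin m) (Fin p) (Set ℝ*) :=
  fun i j => ∑ k, emul (M i k) (N k j)

/-- Entrywise (Minkowski) sum of matrices over external numbers. -/
def matAdd {m n : ℕ} (M N : Matrix (Fin m) (Fin n) (Set ℝ*)) :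
    Matrix (Fin m) (Fin n) (Set ℝ*) := fun i j => M i j + N i j

/-- Entrywise scalar multiple of a matrix by an external number. -/
def matSmul {m n : ℕ} (α : Set ℝ*) (M : Matrix (Fin m) (Fin n) (Set ℝ*)) :
    Matrix (Fin m) (Fin n) (Set ℝ*) := fun i j => emul α (M i j)

/-- Entrywise inclusion of matrices over external numbers. -/
def matIncl {m n : ℕ} (M N : Matrix (Fin m) (Fin n) (Set ℝ*)) : Prop :=
  ∀ i j, M i j ⊆ N i j

/-- Determinant of a square matrix over the external numbers. -/
def detE {n : ℕ} (M : Matrix (Fin n) (Fin n) (Set ℝ*)) : Set ℝ* :=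
  ∑ σ : Equiv.Perm (Fin n),
    esmul ((Equiv.Perm.sign σ : ℤ) : ℝ*) (eprod fun i => M i (σ i))

/-- The `(i,j)` minor of a square matrix over the external numbers. -/
def minorE {n : ℕ} (M : Matrix (Fin (n + 1)) (Fin (n + 1)) (Set ℝ*))
    (i j : Fin (n + 1)) : Set ℝ* :=
  detE (M.submatrix i.succAbove j.succAbove)

/-- The near-identity matrix `I_n(N)`: diagonal entries `1 + N`, off-diagonal entries `N`. -/
def Iun (n : ℕ) (N : Set ℝ*) : Matrix (Fin n) (Fin n) (Set ℝ*) :=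
  fun i j => if i = j then coset 1 N else N

/-- A finite family of vectors of external numbers is linearly dependent:
some nontrivial real (hyperreal) linear combination is a neutrix vector. -/
def LinDepE {ι : Type*} [Fintype ι] {n : ℕ} (ξ : ι → Fin n → Set ℝ*) : Prop :=
  ∃ t : ι → ℝ*, (∃ i, t i ≠ 0) ∧ ∃ A : Fin n → Set ℝ*,
    (∀ j, IsNeutrix (A j)) ∧ ∀ j, (∑ i, esmul (t i) (ξ i j)) = A j

/-- The matrix has a zeroless minor of order `k`. -/
def HasZerolessMinor {m n : ℕ} (M : Matrix (Fin m) (Fin n) (Set ℝ*)) (k : ℕ) : Prop :=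
  ∃ (f : Fin k → Fin m) (g : Fin k → Fin n), Function.Injective f ∧ Function.Injective g ∧
    Zeroless (detE fun i j => M (f i) (g j))

/-- The minor rank of `M` is `r`. -/
def minorRankIs {m n : ℕ} (M : Matrix (Fin m) (Fin n) (Set ℝ*)) (r : ℕ) : Prop :=
  HasZerolessMinor M r ∧ ∀ k, HasZerolessMinor M k → k ≤ r

/-- The row rank of `M` is `r`: the maximal cardinality of a linearly
independent set of row vectors of `M` is `r`. -/
def rowRankIs {m n : ℕ} (M : Matrix (Fin m) (Fin n) (Set ℝ*)) (r : ℕ) : Prop :=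
  (∃ s : Finset (Fin m), s.card = r ∧ ¬ LinDepE fun (i : {x // x ∈ s}) j => M i.1 j) ∧
  ∀ s : Finset (Fin m), (¬ LinDepE fun (i : {x // x ∈ s}) j => M i.1 j) → s.card ≤ r

/-- `M` is a reduced matrix: `max_{i,j} |α_{ij}| = 1 + A₀` for some neutrix `A₀ ⊆ ⊘`. -/
def IsReducedMat {m n : ℕ} (M : Matrix (Fin m) (Fin n) (Set ℝ*)) : Prop :=
  ∃ A₀, IsNeutrix A₀ ∧ A₀ ⊆ oslash ∧ (∃ i j, eabs (M i j) = coset 1 A₀) ∧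
    ∀ i j, ele (eabs (M i j)) (coset 1 A₀)

namespace IsNeutrix

variable {A B C : Set ℝ*}

theorem mem_of_abs_le (hA : IsNeutrix A) {x z : ℝ*} (hx : x ∈ A) (h : |z| ≤ |x|) : z ∈ A := by
  obtain ⟨-, -, hneg, hconv⟩ := hA
  have habs : |x| ∈ A := by
    rcases abs_choice x with h' | h' <;> rw [h']
    exacts [hx, hneg x hx]
  exact hconv _ (hneg _ habs) _ habs z (neg_le_of_abs_le h) (le_of_abs_le h)

theorem add_mem (hA : IsNeutrix A) {x y : ℝ*} (hx : x ∈ A) (hy : y ∈ A) : x + y ∈ A :=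
  hA.2.1 x hx y hy

theorem neg_mem (hA : IsNeutrix A) {x : ℝ*} (hx : x ∈ A) : -x ∈ A := hA.2.2.1 x hx

theorem sub_mem (hA : IsNeutrix A) {x y : ℝ*} (hx : x ∈ A) (hy : y ∈ A) : x - y ∈ A :=
  sub_eq_add_neg x y ▸ hA.add_mem hx (hA.neg_mem hy)

theorem subset_total (hA : IsNeutrix A) (hB : IsNeutrix B) : A ⊆ B ∨ B ⊆ A := by
  by_contra! h
  obtain ⟨x, hxA, hxB⟩ := Set.not_subset.1 h.1
  obtain ⟨y, hyB, hyA⟩ := Set.not_subset.1 h.2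
  rcases le_total |x| |y| with h | h
  exacts [hxB (hB.mem_of_abs_le hyB h), hyA (hA.mem_of_abs_le hxA h)]

theorem zero : IsNeutrix (0 : Set ℝ*) := by
  refine ⟨rfl, ?_, ?_, ?_⟩
  · rintro x rfl y rfl
    simp
  · rintro x rfl
    simp
  · rintro x rfl y rfl z h₁ h₂
    exact le_antisymm h₂ h₁

theorem add_eq_right (hA : IsNeutrix A) (hB : IsNeutrix B) (h : A ⊆ B) : A + B = B := by
  ext x
  constructor
  · rintro ⟨u, hu, v, hv, rfl⟩
    exact hB.add_mem (h hu) hv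
  · exact fun hx => ⟨0, hA.1, x, hx, zero_add x⟩

theorem add (hA : IsNeutrix A) (hB : IsNeutrix B) : IsNeutrix (A + B) := by
  rcases hA.subset_total hB with h | h
  · rwa [hA.add_eq_right hB h]
  · rwa [add_comm, hB.add_eq_right hA h]

theorem sum {ι : Type*} (s : Finset ι) {B : ι → Set ℝ*} (hB : ∀ i, IsNeutrix (B i)) :
    IsNeutrix (∑ i ∈ s, B i) := by
  induction s using Finset.induction_on with
  | empty => simpa using zero
  | insert i s hi ih =>
    rw [Finset.sum_insert hi]
    exact (hB i).add ih

theorem div_mul_mem (hB : IsNeutrix B) {a u v : ℝ*} (h : |u| ≤ |a|) (hv : v ∈ B) :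
    u / a * v ∈ B := by
  refine hB.mem_of_abs_le hv ?_
  rw [abs_mul, abs_div]
  exact mul_le_of_le_one_left (abs_nonneg v) (div_le_one_of_le₀ h (abs_nonneg a))

theorem mul_mem_smul (hB : IsNeutrix B) {a u v : ℝ*} (h : |u| ≤ |a|) (hv : v ∈ B) :
    u * v ∈ a • B := by
  refine ⟨u / a * v, hB.div_mul_mem h hv, ?_⟩
  rcases eq_or_ne a 0 with rfl | ha
  · have : u = 0 := by simpa using h
    simp [this]
  · simp only [smul_eq_mul]
    field_simp

theorem smul_add_mem (hB : IsNeutrix B) (a : ℝ*) {x y : ℝ*} (hx : x ∈ a • B) (hy : y ∈ a • B) :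
    x + y ∈ a • B := by
  obtain ⟨u, hu, rfl⟩ := hx
  obtain ⟨v, hv, rfl⟩ := hy
  exact ⟨u + v, hB.add_mem hu hv, smul_add a u v⟩

theorem mul_add_mem (hB : IsNeutrix B) {x y : ℝ*} (hx : x ∈ A * B) (hy : y ∈ A * B) :
    x + y ∈ A * B := by
  have key {u v u' v' : ℝ*} (hu : u ∈ A) (hv : v ∈ B) (hv' : v' ∈ B) (h : |u'| ≤ |u|) :
      u * v + u' * v' ∈ A * B := by
    obtain ⟨w, hw, hw'⟩ := hB.smul_add_mem u ⟨v, hv, rfl⟩ (hB.mul_mem_smul h hv')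
    exact ⟨u, hu, w, hw, hw'⟩
  obtain ⟨u, hu, v, hv, rfl⟩ := hx
  obtain ⟨u', hu', v', hv', rfl⟩ := hy
  rcases le_total |u'| |u| with h | h
  · exact key hu hv hv' h
  · simpa only [add_comm] using key hu' hv' hv h

theorem mul_add (hA : IsNeutrix A) (hB : IsNeutrix B) (hC : IsNeutrix C) :
    A * (B + C) = A * B + A * C := by
  have key {B C : Set ℝ*} (hB : IsNeutrix B) (hC : IsNeutrix C) (h : B ⊆ C) :
      A * (B + C) = A * B + A * C := by
    rw [hB.add_eq_right hC h]
    ext x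
    constructor
    · exact fun hx => ⟨0, ⟨0, hA.1, 0, hB.1, zero_mul 0⟩, x, hx, zero_add x⟩
    · rintro ⟨y, hy, z, hz, rfl⟩
      exact hC.mul_add_mem (Set.mul_subset_mul_left h hy) hz
  rcases hB.subset_total hC with h | h
  · exact key hB hC h
  · rw [add_comm B, key hC hB h, add_comm]

theorem mul_sum {ι : Type*} (s : Finset ι) {B : ι → Set ℝ*} (hA : IsNeutrix A)
    (hB : ∀ i, IsNeutrix (B i)) : A * ∑ i ∈ s, B i = ∑ i ∈ s, A * B i := by
  induction s using Finset.induction_on with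
  | empty =>
    ext x
    simp only [Finset.sum_empty]
    constructor
    · rintro ⟨u, -, v, rfl, rfl⟩
      simp
    · rintro rfl
      exact ⟨0, hA.1, 0, rfl, zero_mul 0⟩
  | insert i s hi ih =>
    rw [Finset.sum_insert hi, Finset.sum_insert hi, hA.mul_add (hB i) (sum s hB), ih]

end IsNeutrix

theorem coset_zero (A : Set ℝ*) : coset 0 A = A := by
  ext x
  simp [coset]

theorem coset_add (a b : ℝ*) (A B : Set ℝ*) : coset (a + b) (A + B) = coset a A + coset b B := by
  ext x
  constructor
  · rintro ⟨_, ⟨u, hu, v, hv, rfl⟩, rfl⟩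
    exact ⟨a + u, ⟨u, hu, rfl⟩, b + v, ⟨v, hv, rfl⟩, add_add_add_comm a u b v⟩
  · rintro ⟨_, ⟨u, hu, rfl⟩, _, ⟨v, hv, rfl⟩, rfl⟩
    exact ⟨u + v, ⟨u, hu, v, hv, rfl⟩, add_add_add_comm a u b v⟩

theorem coset_sum {ι : Type*} (s : Finset ι) (b : ι → ℝ*) (B : ι → Set ℝ*) :
    coset (∑ i ∈ s, b i) (∑ i ∈ s, B i) = ∑ i ∈ s, coset (b i) (B i) := by
  induction s using Finset.induction_on with
  | empty => simp [coset_zero]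
  | insert i s hi ih => rw [Finset.sum_insert hi, Finset.sum_insert hi, Finset.sum_insert hi,
      coset_add, ih]

theorem coset_eq_self_of_zero_mem {a : ℝ*} {A : Set ℝ*} (hA : IsNeutrix A)
    (h : (0 : ℝ*) ∈ coset a A) : coset a A = A := by
  obtain ⟨u, hu, hau⟩ := h
  have ha : a ∈ A := by
    rw [eq_neg_of_add_eq_zero_left hau.symm]
    exact hA.neg_mem hu
  ext x
  constructor
  · rintro ⟨v, hv, rfl⟩
    exact hA.add_mem ha hv
  · exact fun hx => ⟨x - a, hA.sub_mem hx ha, by ring⟩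

theorem eq_and_sub_mem_of_coset_eq {a a' : ℝ*} {A A' : Set ℝ*} (hA : IsNeutrix A)
    (hA' : IsNeutrix A') (h : coset a A = coset a' A') : A' = A ∧ a' - a ∈ A := by
  obtain ⟨s, hs, has⟩ : a' ∈ coset a A := h ▸ ⟨0, hA'.1, (add_zero a').symm⟩
  obtain ⟨t, ht, hat⟩ : a ∈ coset a' A' := h ▸ ⟨0, hA.1, (add_zero a).symm⟩
  refine ⟨?_, by rwa [has, add_sub_cancel_left]⟩
  ext x
  constructor
  · intro hx
    obtain ⟨y, hy, hxy⟩ : a' + x ∈ coset a A := h ▸ ⟨x, hx, rfl⟩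
    rw [show x = y - s by linear_combination hxy - has]
    exact hA.sub_mem hy hs
  · intro hx
    obtain ⟨y, hy, hxy⟩ : a + x ∈ coset a' A' := h ▸ ⟨x, hx, rfl⟩
    rw [show x = y - t by linear_combination hxy - hat]
    exact hA'.sub_mem hy ht

theorem emul_coset_subset {a b : ℝ*} {A B P : Set ℝ*} (hA : IsNeutrix A) (hB : IsNeutrix B)
    (hadd : ∀ x ∈ P, ∀ y ∈ P, x + y ∈ P) (haB : ∀ v ∈ B, a * v ∈ P) (hbA : ∀ u ∈ A, b * u ∈ P)
    (hAB : ∀ u ∈ A, ∀ v ∈ B, u * v ∈ P) :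
    emul (coset a A) (coset b B) ⊆ coset (a * b) P := by
  rintro z ⟨a', A', b', B', hA', hB', hα, hβ, u, hu, v, hv, u', hu', v', hv', rfl⟩
  obtain ⟨rfl, hs⟩ := eq_and_sub_mem_of_coset_eq hA hA' hα
  obtain ⟨rfl, ht⟩ := eq_and_sub_mem_of_coset_eq hB hB' hβ
  refine ⟨(a * ((b' - b) + v) + b * ((a' - a) + u)) +
    (((a' - a) * ((b' - b) + v) + u * (b' - b)) + u' * v'), ?_, by ring⟩
  have htv := hB.add_mem ht hv
  exact hadd _ (hadd _ (haB _ htv) _ (hbA _ (hA.add_mem hs hu))) _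
    (hadd _ (hadd _ (hAB _ hs _ htv) _ (hAB _ hu _ ht)) _ (hAB _ hu' _ hv'))

theorem emul_coset_eq_smul {a b : ℝ*} {A B : Set ℝ*} (hA : IsNeutrix A) (hB : IsNeutrix B)
    (ha : ∀ u ∈ A, |u| ≤ |a|) (hbA : ∀ u ∈ A, b * u ∈ a • B) :
    emul (coset a A) (coset b B) = coset (a * b) (a • B) := by
  refine (emul_coset_subset hA hB (fun x hx y hy => hB.smul_add_mem a hx hy)
    (fun v hv => ⟨v, hv, rfl⟩) hbA fun u hu v hv => hB.mul_mem_smul (ha u hu) hv).antisymm ?_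
  rintro _ ⟨_, ⟨v, hv, rfl⟩, rfl⟩
  exact ⟨a, A, b, B, hA, hB, rfl, rfl, 0, hA.1, v, hv, 0, hA.1, 0, hB.1, by simp⟩

theorem emul_eq_mul {A B : Set ℝ*} (hA : IsNeutrix A) (hB : IsNeutrix B) :
    emul A B = A * B := by
  have h0 : (0 : ℝ*) ∈ A * B := ⟨0, hA.1, 0, hB.1, zero_mul 0⟩
  apply subset_antisymm
  · have h := emul_coset_subset (a := 0) (b := 0) (P := A * B) hA hB
      (fun x hx y hy => hB.mul_add_mem hx hy) (by simpa using fun _ _ => h0)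
      (by simpa using fun _ _ => h0) fun u hu v hv => ⟨u, hu, v, hv, rfl⟩
    simpa only [coset_zero, mul_zero] using h
  · rintro _ ⟨u, hu, v, hv, rfl⟩
    exact ⟨0, A, 0, B, hA, hB, (coset_zero A).symm, (coset_zero B).symm,
      0, hA.1, 0, hB.1, u, hu, v, hv, by simp⟩

theorem zero_mem_of_RU_eq_univ {β : Set ℝ*} (h : RU β = Set.univ) : (0 : ℝ*) ∈ β := by
  by_contra h0
  rw [RU, if_neg h0] at h
  obtain ⟨b, B, hB, rfl, u, hu, hub⟩ := h.symm ▸ Set.mem_univ (1 : ℝ*)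
  have hb : b ≠ 0 := by
    rintro rfl
    simp at hub
  have hu' : u = b := ((div_eq_one_iff_eq hb).1 hub.symm)
  exact h0 ⟨-u, hB.neg_mem hu, by rw [hu', add_neg_cancel]⟩

theorem abs_le_of_zero_notMem_coset {a : ℝ*} {A : Set ℝ*} (hA : IsNeutrix A)
    (h : (0 : ℝ*) ∉ coset a A) {u : ℝ*} (hu : u ∈ A) : |u| ≤ |a| := by
  by_contra! hlt
  exact h ⟨-a, hA.neg_mem (hA.mem_of_abs_le hu hlt.le), (add_neg_cancel a).symm⟩

theorem exists_coset_mul_mem_smul {a : ℝ*} {A β : Set ℝ*} (hA : IsNeutrix A)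
    (h0 : (0 : ℝ*) ∉ coset a A) (hβ : IsExt β) (hR : RU (coset a A) ⊆ RU β) :
    ∃ b B, IsNeutrix B ∧ β = coset b B ∧ ∀ u ∈ A, b * u ∈ a • B := by
  obtain ⟨b, B, hB, rfl⟩ := hβ
  by_cases hb0 : (0 : ℝ*) ∈ coset b B
  · refine ⟨0, B, hB, ?_, fun u _ => ⟨0, hB.1, by simp⟩⟩
    rw [coset_zero, coset_eq_self_of_zero_mem hB hb0]
  refine ⟨b, B, hB, rfl, fun u hu => ?_⟩
  have ha : a ≠ 0 := by
    rintro rfl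
    exact h0 ⟨0, hA.1, (add_zero 0).symm⟩
  rw [RU, RU, if_neg h0, if_neg hb0] at hR
  obtain ⟨b', B', hB', hβ, v, hv, huv⟩ := hR ⟨a, A, hA, rfl, u, hu, rfl⟩
  have hb' : b' ≠ 0 := by
    rintro rfl
    exact hb0 (hβ ▸ ⟨0, hB'.1, (add_zero 0).symm⟩)
  obtain ⟨rfl, ht⟩ := eq_and_sub_mem_of_coset_eq hB hB' hβ
  rw [div_eq_div_iff ha hb'] at huv
  rw [show b * u = a * v + u * -(b' - b) by linear_combination huv]
  exact hB.smul_add_mem a ⟨v, hv, rfl⟩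
    (hB.mul_mem_smul (abs_le_of_zero_notMem_coset hA h0 hu) (hB.neg_mem ht))

theorem stmt2 (n : ℕ) (hn : 1 ≤ n) (α : Set ℝ*) (β : Fin n → Set ℝ*)
    (hα : IsExt α) (hβ : ∀ i, IsExt (β i)) (hR : ∀ i, RU α ⊆ RU (β i)) :
    emul α (∑ i, β i) = ∑ i, emul α (β i) := by
  obtain ⟨a, A, hA, rfl⟩ := hα
  by_cases h0 : (0 : ℝ*) ∈ coset a A
  · have hβ' (i) : IsNeutrix (β i) := by
      obtain ⟨b, B, hB, hbB⟩ := hβ i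
      have h := hR i
      rw [RU, if_pos h0] at h
      have hz := zero_mem_of_RU_eq_univ (Set.univ_subset_iff.1 h)
      rw [hbB] at hz ⊢
      rwa [coset_eq_self_of_zero_mem hB hz]
    rw [coset_eq_self_of_zero_mem hA h0, emul_eq_mul hA (.sum _ hβ'), hA.mul_sum _ hβ']
    exact Finset.sum_congr rfl fun i _ => (emul_eq_mul hA (hβ' i)).symm
  · choose b B hB hbB hbA using fun i => exists_coset_mul_mem_smul hA h0 (hβ i) (hR i)
    have ha (u) (hu : u ∈ A) := abs_le_of_zero_notMem_coset hA h0 hu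
    obtain rfl : β = fun i => coset (b i) (B i) := funext hbB
    have hsum : ∀ u ∈ A, (∑ i, b i) * u ∈ a • ∑ i, B i := fun u hu => by
      rw [Finset.sum_mul, Finset.smul_sum]
      exact Set.finsetSum_mem_finsetSum _ _ _ fun i _ => hbA i u hu
    rw [← coset_sum, emul_coset_eq_smul hA (.sum _ hB) ha hsum, Finset.mul_sum, Finset.smul_sum,
      coset_sum]
    exact Finset.sum_congr rfl fun i _ => (emul_coset_eq_smul hA (hB i) ha (hbA i)).symm
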